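/- arXiv:2111.13417 — 2 statements merged into one kernel-verified Lean document; each statement's English description precedes it below -/
import Mathlib

section
/- Let N ≥ 1, let Ω ⊂ ℝ^N be a bounded open set, and let h ∈ L¹(Ω) with h ≥ 0 a.e. and ∫_Ω h dx = 1. Then there exist y ∈ ℝ^N and t > 0 such that ∫_Ω h(x) · 2t(x−y)/(1+t²|x−y|²) dx = 0 (as a vector in ℝ^N) and ∫_Ω h(x) · (1−t²|x−y|²)/(1+t²|x−y|²) dx = 0. -/
open MeasureTheory Real

noncomputable section

abbrev Euc (N : ℕ) := EuclideanSpace ℝ (Fin N)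

open Filter Topology

/-- The integrand of the functional to be minimised. -/
def GG {N : ℕ} (p : Euc N × ℝ) (x : Euc N) : ℝ :=
  Real.log (Real.exp (-p.2) + Real.exp p.2 * ‖x - p.1‖ ^ 2)

lemma GG_arg_pos {N : ℕ} (y x : Euc N) (u : ℝ) :
    0 < Real.exp (-u) + Real.exp u * ‖x - y‖ ^ 2 := by positivity

lemma GG_cont {N : ℕ} : Continuous (Function.uncurry (GG (N := N))) := by
  unfold GG Function.uncurry
  refine Continuous.log (by fun_prop) ?_
  intro a
  exact (GG_arg_pos _ _ _).ne'

lemma two_mul_le_arg {N : ℕ} (y x : Euc N) (u : ℝ) :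
    2 * ‖x - y‖ ≤ Real.exp (-u) + Real.exp u * ‖x - y‖ ^ 2 := by
  have h1 : Real.exp (-u) * Real.exp u = 1 := by rw [← Real.exp_add]; simp
  have h2 := Real.exp_pos u
  have h3 := Real.exp_pos (-u)
  have : Real.exp (-u) + Real.exp u * ‖x - y‖ ^ 2 - 2 * ‖x - y‖
      = Real.exp (-u) * (1 - Real.exp u * ‖x - y‖) ^ 2 := by
    linear_combination (2 * ‖x - y‖ - Real.exp u * ‖x - y‖ ^ 2) * h1
  have : 0 ≤ Real.exp (-u) * (1 - Real.exp u * ‖x - y‖) ^ 2 := by positivity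
  linarith

lemma balance {N : ℕ} (ν : Measure (Euc N)) [IsProbabilityMeasure ν] (R : ℝ) (hR : 0 ≤ R)
    (hνR : ∀ᵐ x ∂ν, ‖x‖ ≤ R) (δ : ℝ) (hδ : 0 < δ)
    (hsmall : ∀ y : Euc N, ν.real (Metric.ball y δ) ≤ 1 / 4) :
    ∃ (y : Euc N) (t : ℝ), 0 < t ∧
      (∫ x, (2 * t / (1 + t ^ 2 * ‖x - y‖ ^ 2)) • (x - y) ∂ν) = (0 : Euc N) ∧
      (∫ x, ((1 - t ^ 2 * ‖x - y‖ ^ 2) / (1 + t ^ 2 * ‖x - y‖ ^ 2)) ∂ν) = 0 := by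
  have hres : ν.restrict (Metric.closedBall 0 R) = ν := by
    exact Measure.restrict_eq_self_of_ae_mem (by simpa using hνR)
  have hK : IsCompact (Metric.closedBall (0 : Euc N) R) := isCompact_closedBall _ _
  have hintg : ∀ g : Euc N → ℝ, Continuous g → Integrable g ν := by
    intro g hg
    have := hg.continuousOn.integrableOn_compact (μ := ν) hK
    rwa [IntegrableOn, hres] at this
  have hintg' : ∀ g : Euc N → Euc N, Continuous g → Integrable g ν := by
    intro g hg
    have := hg.continuousOn.integrableOn_compact (μ := ν) hK
    rwa [IntegrableOn, hres] at this
  have hGc : ∀ p, Continuous (GG (N := N) p) := fun p => GG_cont.comp (by fun_prop : Continuous fun x => (p, x))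
  have hGi : ∀ p, Integrable (GG (N := N) p) ν := fun p => hintg _ (hGc p)
  set F : Euc N × ℝ → ℝ := fun p => ∫ x, GG p x ∂ν with hF
  have hFc : Continuous F := by
    have := continuous_parametric_integral_of_continuous (μ := ν) (GG_cont (N := N)) hK
    rwa [hres] at this
  have b1 : ∀ y u, -u ≤ F (y, u) := by
    intro y u
    have : ∫ x, (-u) ∂ν ≤ F (y, u) := by
      refine integral_mono (integrable_const _) (hGi _) fun x => ?_
      show -u ≤ Real.log _
      rw [Real.le_log_iff_exp_le (GG_arg_pos _ _ _)]
      have : 0 ≤ Real.exp u * ‖x - y‖ ^ 2 := by positivity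
      simpa using this
    simpa using this
  have b2 : ∀ y u, R < ‖y‖ → Real.log (‖y‖ - R) ≤ F (y, u) := by
    intro y u hy
    have : ∫ x, Real.log (‖y‖ - R) ∂ν ≤ F (y, u) := by
      refine integral_mono_ae (integrable_const _) (hGi _) ?_
      filter_upwards [hνR] with x hx
      show _ ≤ Real.log _
      refine Real.log_le_log (by linarith) ?_
      refine le_trans ?_ (two_mul_le_arg y x u)
      have h1 : ‖y‖ - ‖x‖ ≤ ‖x - y‖ := by
        rw [norm_sub_rev]; exact norm_sub_norm_le _ _
      have := norm_nonneg (x - y)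
      linarith
    simpa using this
  have b3 : ∀ y u, 0 ≤ u + Real.log δ → u / 2 + 3 / 2 * Real.log δ ≤ F (y, u) := by
    intro y u hu
    have hm : MeasurableSet (Metric.ball y δ)ᶜ := measurableSet_ball.compl
    have hi : Integrable ((Metric.ball y δ)ᶜ.indicator fun _ => 2 * (u + Real.log δ)) ν :=
      (integrable_const _).indicator hm
    have h1 : ∫ x, (-u + (Metric.ball y δ)ᶜ.indicator (fun _ => 2 * (u + Real.log δ)) x) ∂ν
        ≤ F (y, u) := by
      refine integral_mono ((integrable_const _).add hi) (hGi _) fun x => ?_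
      show _ ≤ Real.log _
      by_cases hx : x ∈ (Metric.ball y δ)ᶜ
      · simp only [Set.indicator_of_mem hx]
        rw [Real.le_log_iff_exp_le (GG_arg_pos _ _ _)]
        have e : -u + 2 * (u + Real.log δ) = u + Real.log δ + Real.log δ := by ring
        rw [e, Real.exp_add, Real.exp_add, Real.exp_log hδ]
        have hd : δ ≤ ‖x - y‖ := by simpa [dist_eq_norm] using hx
        have : Real.exp u * δ * δ ≤ Real.exp u * ‖x - y‖ ^ 2 := by
          rw [mul_assoc, ← sq]; gcongr
        linarith [Real.exp_pos (-u)]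
      · simp only [Set.indicator_of_notMem hx, add_zero]
        rw [Real.le_log_iff_exp_le (GG_arg_pos _ _ _)]
        have : 0 ≤ Real.exp u * ‖x - y‖ ^ 2 := by positivity
        simpa using this
    rw [integral_add (integrable_const _) hi, integral_indicator hm] at h1
    simp only [integral_const, probReal_univ, smul_eq_mul, measureReal_restrict_apply_univ,
      probReal_compl_eq_one_sub (measurableSet_ball (x := y) (ε := δ))] at h1
    have := hsmall y
    nlinarith
  obtain ⟨⟨y, u⟩, hmin⟩ : ∃ p, ∀ q, F p ≤ F q := by
    refine hFc.exists_forall_le' (0 : Euc N × ℝ) ?_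
    set M := F 0
    set C := R + Real.exp M + 2 * |M| + 3 * |Real.log δ| with hC
    have := (isCompact_closedBall (0 : Euc N × ℝ) C).compl_mem_cocompact
    filter_upwards [this] with p hp
    obtain ⟨y, u⟩ := p
    have hp' : C < ‖y‖ ∨ C < |u| := by
      have : C < max ‖y‖ |u| := by simpa [Prod.norm_def, or_iff_not_imp_left] using hp
      exact lt_max_iff.1 this
    have e0 := Real.exp_pos M
    have e1 := abs_nonneg M
    have e2 := le_abs_self M
    have e3 := abs_nonneg (Real.log δ)
    have e4 := neg_abs_le (Real.log δ)
    rcases hp' with hy | hu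
    · refine le_trans ?_ (b2 y u (by linarith))
      rw [Real.le_log_iff_exp_le (by linarith)]
      linarith
    · rcases lt_abs.1 hu with hu | hu
      · exact le_trans (by linarith) (b3 y u (by linarith))
      · exact le_trans (by linarith) (b1 y u)
  have hexp : Real.exp (-u) * Real.exp u = 1 := by rw [← Real.exp_add]; simp
  have hpu := Real.exp_pos u
  have hpnu := Real.exp_pos (-u)
  refine ⟨y, Real.exp u, Real.exp_pos u, ?_, ?_⟩
  · set V : Euc N → Euc N :=
      fun x => (2 * Real.exp u / (1 + Real.exp u ^ 2 * ‖x - y‖ ^ 2)) • (x - y) with hV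
    have hVc : Continuous V := by
      have hc : Continuous fun x : Euc N =>
          2 * Real.exp u / (1 + Real.exp u ^ 2 * ‖x - y‖ ^ 2) := by
        refine Continuous.div (by fun_prop) (by fun_prop) ?_
        intro x
        positivity
      exact hc.smul (by fun_prop)
    have hVi := hintg' V hVc
    have key : ∀ v : Euc N, inner ℝ v (∫ x, V x ∂ν) = 0 := by
      intro v
      have hd := hasDerivAt_integral_of_dominated_loc_of_deriv_le (μ := ν) (𝕜 := ℝ)
        (F := fun s x => GG (y + s • v, u) x) (x₀ := 0) (s := Set.univ)
        (F' := fun s x => (Real.exp u * (2 * inner ℝ (x - (y + s • v)) (-v))) /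
          (Real.exp (-u) + Real.exp u * ‖x - (y + s • v)‖ ^ 2))
        (bound := fun _ => Real.exp u * ‖v‖) univ_mem
        (Eventually.of_forall fun s => (hGc _).aestronglyMeasurable) (hGi _)
        (Continuous.aestronglyMeasurable (Continuous.div (by fun_prop) (by fun_prop)
          fun x => (GG_arg_pos _ _ _).ne'))
        (Eventually.of_forall fun x s _ => by
          have h1 := abs_real_inner_le_norm (x - (y + s • v)) (-v)
          have h2 := two_mul_le_arg (y + s • v) x u
          have h3 := GG_arg_pos (y + s • v) x u
          rw [Real.norm_eq_abs, abs_div, abs_of_pos h3, div_le_iff₀ h3, abs_mul, abs_mul,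
            abs_of_pos hpu, abs_two, mul_assoc]
          rw [norm_neg] at h1
          have h4 := norm_nonneg v
          refine mul_le_mul_of_nonneg_left ?_ hpu.le
          nlinarith)
        (integrable_const _)
        (Eventually.of_forall fun x s _ => by
          have h0 : HasDerivAt (fun s : ℝ => x - (y + s • v)) (-v) s := by
            have := ((hasDerivAt_id s).smul_const v).const_add y |>.const_sub x
            simpa using this
          have := ((h0.norm_sq.const_mul (Real.exp u)).const_add (Real.exp (-u))).log
            (GG_arg_pos _ _ _).ne'
          exact this)
      have hz := IsLocalMin.hasDerivAt_eq_zero (a := (0 : ℝ))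
        (Eventually.of_forall fun s => by
          simpa using hmin (y + s • v, u)) hd.2
      rw [← integral_inner hVi]
      have : ∀ x, inner ℝ v (V x) = - Real.exp (-u) * ((Real.exp u * (2 * inner ℝ (x - (y + (0:ℝ) • v)) (-v))) /
          (Real.exp (-u) + Real.exp u * ‖x - (y + (0:ℝ) • v)‖ ^ 2)) := by
        intro x
        have h3 := GG_arg_pos y x u
        have h5 : 0 < 1 + Real.exp u ^ 2 * ‖x - y‖ ^ 2 := by positivity
        simp only [hV, zero_smul, add_zero, inner_smul_right, inner_neg_right,
          real_inner_comm (x - y) v]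
        field_simp
        linear_combination (-(Real.exp u * inner ℝ (x - y) v * ‖x - y‖ ^ 2)) * hexp
      simp_rw [this]
      rw [integral_const_mul, hz, mul_zero]
    exact inner_self_eq_zero.1 (key _)
  · have hd := hasDerivAt_integral_of_dominated_loc_of_deriv_le (μ := ν) (𝕜 := ℝ)
        (F := fun s x => GG (y, s) x) (x₀ := u) (s := Set.univ)
        (F' := fun s x => (-Real.exp (-s) + Real.exp s * ‖x - y‖ ^ 2) /
          (Real.exp (-s) + Real.exp s * ‖x - y‖ ^ 2))
        (bound := fun _ => 1) univ_mem
        (Eventually.of_forall fun s => (hGc _).aestronglyMeasurable) (hGi _)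
        (Continuous.aestronglyMeasurable (Continuous.div (by fun_prop) (by fun_prop)
          fun x => (GG_arg_pos _ _ _).ne'))
        (Eventually.of_forall fun x s _ => by
          have h3 := GG_arg_pos y x s
          have h4 : 0 ≤ Real.exp s * ‖x - y‖ ^ 2 := by positivity
          have h5 := Real.exp_pos (-s)
          rw [Real.norm_eq_abs, abs_div, abs_of_pos h3, div_le_iff₀ h3, abs_le]
          constructor <;> linarith)
        (integrable_const _)
        (Eventually.of_forall fun x s _ => by
          have h1 : HasDerivAt (fun s : ℝ => Real.exp (-s)) (-Real.exp (-s)) s := by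
            simpa using (hasDerivAt_neg s).exp
          have h2 : HasDerivAt (fun s : ℝ => Real.exp (-s) + Real.exp s * ‖x - y‖ ^ 2)
              (-Real.exp (-s) + Real.exp s * ‖x - y‖ ^ 2) s :=
            h1.add ((Real.hasDerivAt_exp s).mul_const _)
          exact h2.log (GG_arg_pos _ _ _).ne')
    have hz := IsLocalMin.hasDerivAt_eq_zero (a := u)
        (Eventually.of_forall fun s => hmin (y, s)) hd.2
    have : ∀ x, (1 - Real.exp u ^ 2 * ‖x - y‖ ^ 2) / (1 + Real.exp u ^ 2 * ‖x - y‖ ^ 2)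
        = - ((-Real.exp (-u) + Real.exp u * ‖x - y‖ ^ 2) /
          (Real.exp (-u) + Real.exp u * ‖x - y‖ ^ 2)) := by
      intro x
      have h3 := GG_arg_pos y x u
      have h5 : 0 < 1 + Real.exp u ^ 2 * ‖x - y‖ ^ 2 := by positivity
      rw [← neg_div, div_eq_div_iff h5.ne' h3.ne']
      linear_combination (-2 * Real.exp u * ‖x - y‖ ^ 2) * hexp
    simp_rw [this]
    rw [integral_neg, hz, neg_zero]

/-- Lemma 3.2 / balancing via Brouwer's fixed point theorem.
For a nonnegative `h ∈ L¹(Ω)` with `∫_Ω h = 1` there exist `y ∈ ℝ^N` and `t > 0` such that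
`∫_Ω h(x)·2t(x-y)/(1+t²|x-y|²) dx = 0` and `∫_Ω h(x)·(1-t²|x-y|²)/(1+t²|x-y|²) dx = 0`. -/
theorem statement2 (N : ℕ) (hN : 1 ≤ N)
    (Ω : Set (Euc N)) (hΩo : IsOpen Ω) (hΩb : Bornology.IsBounded Ω)
    (h : Euc N → ℝ) (hint : IntegrableOn h Ω volume)
    (hpos : ∀ᵐ x ∂(volume : Measure (Euc N)).restrict Ω, 0 ≤ h x)
    (hone : (∫ x in Ω, h x) = 1) :
    ∃ (y : Euc N) (t : ℝ), 0 < t ∧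
      (∫ x in Ω, (h x * (2 * t / (1 + t ^ 2 * ‖x - y‖ ^ 2))) • (x - y)) = (0 : Euc N) ∧
      (∫ x in Ω, h x * ((1 - t ^ 2 * ‖x - y‖ ^ 2) / (1 + t ^ 2 * ‖x - y‖ ^ 2))) = 0 := by
  haveI : Nonempty (Fin N) := ⟨⟨0, hN⟩⟩
  have hm : AEMeasurable (fun x => ENNReal.ofReal (h x)) (volume.restrict Ω) :=
    hint.aestronglyMeasurable.aemeasurable.ennreal_ofReal
  set ν := (volume.restrict Ω).withDensity (fun x => ENNReal.ofReal (h x)) with hν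
  have htot : ∫⁻ x in Ω, ENNReal.ofReal (h x) = 1 := by
    rw [← ofReal_integral_eq_lintegral_ofReal hint hpos, hone, ENNReal.ofReal_one]
  haveI : IsProbabilityMeasure ν := ⟨by
    rw [hν, withDensity_apply _ MeasurableSet.univ, Measure.restrict_univ, htot]⟩
  obtain ⟨R, hR⟩ := hΩb.exists_norm_le
  have hνR : ∀ᵐ x ∂ν, ‖x‖ ≤ max R 0 := by
    refine (withDensity_absolutelyContinuous _ _).ae_le ?_
    filter_upwards [ae_restrict_mem hΩo.measurableSet] with x hx
    exact (hR x hx).trans (le_max_left _ _)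
  obtain ⟨η, hη, hηs⟩ := exists_pos_setLIntegral_lt_of_measure_lt
    (μ := (volume : Measure (Euc N)).restrict Ω) (f := fun x => ENNReal.ofReal (h x))
    (by rw [htot]; simp) (ε := ENNReal.ofReal (1 / 4)) (by simp)
  obtain ⟨δ, hδ, hδs⟩ : ∃ δ : ℝ, 0 < δ ∧ volume (Metric.ball (0 : Euc N) δ) < η := by
    have h1 : Tendsto (fun δ : ℝ => volume (Metric.ball (0 : Euc N) δ)) (𝓝[>] 0) (𝓝 0) := by
      have h2 : Tendsto (fun δ : ℝ => ENNReal.ofReal (δ ^ N) * volume (Metric.ball (0 : Euc N) 1))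
          (𝓝[>] 0) (𝓝 0) := by
        have h3 : Tendsto (fun δ : ℝ => ENNReal.ofReal (δ ^ N)) (𝓝 0) (𝓝 0) := by
          have : Continuous (fun δ : ℝ => ENNReal.ofReal (δ ^ N)) :=
            ENNReal.continuous_ofReal.comp (by fun_prop)
          have := this.tendsto 0
          simpa [show N ≠ 0 by omega] using this
        have := ENNReal.Tendsto.mul_const (b := volume (Metric.ball (0 : Euc N) 1)) h3
          (Or.inr measure_ball_lt_top.ne)
        rw [zero_mul] at this
        exact this.mono_left nhdsWithin_le_nhds
      refine h2.congr' ?_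
      filter_upwards [self_mem_nhdsWithin] with δ hδ
      rw [Measure.addHaar_ball_of_pos _ _ hδ]
      simp
    obtain ⟨δ, h3, h4⟩ := ((h1.eventually_lt_const hη).and self_mem_nhdsWithin).exists
    exact ⟨δ, h4, h3⟩
  have hsmall : ∀ y : Euc N, ν.real (Metric.ball y δ) ≤ 1 / 4 := by
    intro y
    have h1 : ν (Metric.ball y δ) < ENNReal.ofReal (1 / 4) := by
      rw [hν, withDensity_apply _ measurableSet_ball]
      refine hηs _ (lt_of_le_of_lt (Measure.restrict_apply_le _ _) ?_)
      rwa [Measure.addHaar_ball_center]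
    exact ENNReal.toReal_le_of_le_ofReal (by norm_num) h1.le
  obtain ⟨y, t, ht, e1, e2⟩ := balance ν (max R 0) (le_max_right _ _) hνR δ hδ hsmall
  refine ⟨y, t, ht, ?_, ?_⟩
  · rw [hν, integral_withDensity_eq_integral_toReal_smul₀ hm (by simp)] at e1
    rw [← e1]
    refine integral_congr_ae ?_
    filter_upwards [hpos] with x hx
    rw [ENNReal.toReal_ofReal hx, mul_smul]
  · rw [hν, integral_withDensity_eq_integral_toReal_smul₀ hm (by simp)] at e2
    rw [← e2]
    refine integral_congr_ae ?_
    filter_upwards [hpos] with x hx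
    rw [ENNReal.toReal_ofReal hx, smul_eq_mul]
end
end

section
/- (Value of α_{N,s}) Let s ∈ (0,1) and let N be an integer with 2s < N < 4s. Then the function y ↦ U_{0,1}(y) h(y) is integrable on ℝ^N and ∫_{ℝ^N} U_{0,1}(y) h(y) dy = (π^{N/2}/Γ(N/2)) · Γ(N/2 − 2s) · ( Γ(s)/Γ(N/2 − s) − Γ(N/2)/Γ(N−2s) ), where Γ(N/2 − 2s) is the Gamma function evaluated at the (non-integer, negative) argument N/2 − 2s ∈ (−1, 0). -/
open MeasureTheory Real

noncomputable section

/-- The Aubin–Talenti bubble `U_{x,λ}(y) = (λ/(1+λ²|x-y|²))^{(N-2s)/2}`. -/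
def bubble (N : ℕ) (s : ℝ) (x : Euc N) (lam : ℝ) (y : Euc N) : ℝ :=
  (lam / (1 + lam ^ 2 * ‖x - y‖ ^ 2)) ^ (((N : ℝ) - 2 * s) / 2)

/-- The bubble–Green discrepancy `h(z) = |z|^{-(N-2s)} - (1+|z|²)^{-(N-2s)/2}`. -/
def hfun (N : ℕ) (s : ℝ) (z : Euc N) : ℝ :=
  ‖z‖ ^ (-((N : ℝ) - 2 * s)) - (1 + ‖z‖ ^ 2) ^ (-(((N : ℝ) - 2 * s) / 2))

lemma beta_real (u v : ℝ) (hu : 0 < u) (hv : 0 < v) :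
    IntervalIntegrable (fun x : ℝ => x ^ (u - 1) * (1 - x) ^ (v - 1)) volume 0 1 ∧
    ∫ x in (0:ℝ)..1, x ^ (u - 1) * (1 - x) ^ (v - 1) =
      Real.Gamma u * Real.Gamma v / Real.Gamma (u + v) := by
  have hc := Complex.betaIntegral_convergent (u := (u:ℂ)) (v := (v:ℂ)) (by simpa) (by simpa)
  have key : ∀ x ∈ Set.Ioc (0:ℝ) 1, (x : ℂ) ^ ((u:ℂ) - 1) * (1 - (x : ℂ)) ^ ((v:ℂ) - 1)
      = ((x ^ (u - 1) * (1 - x) ^ (v - 1) : ℝ) : ℂ) := by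
    intro x hx
    rw [Complex.ofReal_mul, Complex.ofReal_cpow hx.1.le, Complex.ofReal_cpow (by linarith [hx.2])]
    push_cast
    rfl
  have hb := ProbabilityTheory.beta_eq_betaIntegralReal u v hu hv
  have hu1 : Set.uIoc (0:ℝ) 1 = Set.Ioc 0 1 := Set.uIoc_of_le zero_le_one
  constructor
  · have h2 : IntervalIntegrable
        (fun x : ℝ => ((x ^ (u - 1) * (1 - x) ^ (v - 1) : ℝ) : ℂ)) volume 0 1 := by
      refine hc.congr ?_
      rw [hu1]
      intro x hx
      exact key x hx
    rw [intervalIntegrable_iff] at h2 ⊢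
    have h3 : Integrable (fun x : ℝ => x ^ (u - 1) * (1 - x) ^ (v - 1))
        (volume.restrict (Set.uIoc 0 1)) := by simpa using h2.re
    exact h3
  · rw [ProbabilityTheory.beta] at hb
    rw [hb, Complex.betaIntegral]
    have : ∫ (x : ℝ) in (0:ℝ)..1, (x : ℂ) ^ ((u:ℂ) - 1) * (1 - (x : ℂ)) ^ ((v:ℂ) - 1)
        = ∫ (x : ℝ) in (0:ℝ)..1, ((x ^ (u - 1) * (1 - x) ^ (v - 1) : ℝ) : ℂ) := by
      apply intervalIntegral.integral_congr_ae
      refine Filter.Eventually.of_forall fun x hx => ?_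
      rw [hu1] at hx
      exact key x hx
    rw [this, intervalIntegral.integral_ofReal, Complex.ofReal_re]

lemma one_dim (s p c : ℝ) (hs : 0 < s) (hsp : s < p) (hp1 : p - s ≤ 1) (hc : 0 < c) (hc1 : c < 1)
    (hcs : c < s) :
    IntervalIntegrable (fun x : ℝ => (x ^ (s - 1) - x ^ (p - 1)) * (1 - x) ^ (-c - 1)) volume 0 1 ∧
    ∫ x in (0:ℝ)..1, (x ^ (s - 1) - x ^ (p - 1)) * (1 - x) ^ (-c - 1) =
      Real.Gamma (-c) * (Real.Gamma s / Real.Gamma (s - c) - Real.Gamma p / Real.Gamma (p - c)) := by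
  have hp : 0 < p := hs.trans hsp
  obtain ⟨i1, e1⟩ := beta_real s (1 - c) hs (by linarith)
  obtain ⟨i2, e2⟩ := beta_real p (1 - c) hp (by linarith)
  have hc' : 1 - c - 1 = -c := by ring
  rw [hc'] at i1 e1 i2 e2
  have hbd : ∀ x : ℝ, 0 ≤ x → x < 1 → 0 < x → 0 ≤ x ^ s - x ^ p ∧ x ^ s - x ^ p ≤ x ^ s * (1 - x) := by
    intro x h0 h1 h0'
    have ha : x ^ p = x ^ s * x ^ (p - s) := by
      rw [← Real.rpow_add h0']; congr 1; ring
    have h2 : x ≤ x ^ (p - s) := by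
      have := Real.rpow_le_rpow_of_exponent_ge h0' h1.le hp1
      simpa using this
    have h3 : x ^ (p - s) ≤ 1 := Real.rpow_le_one h0 h1.le (by linarith)
    have h4 : 0 ≤ x ^ s := Real.rpow_nonneg h0 _
    rw [ha]
    constructor <;> nlinarith
  have hcx : ∀ x : ℝ, x < 1 → (1 - x) ^ (-c) = (1 - x) ^ (-c - 1) * (1 - x) := by
    intro x h1
    rw [Real.rpow_sub_one (by linarith)]
    field_simp [show (1 - x) ≠ 0 by linarith]
  have hs1 : ∀ x : ℝ, 0 < x → ∀ u : ℝ, x ^ u = x ^ (u - 1) * x := by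
    intro x h1 u
    rw [Real.rpow_sub_one (by linarith)]
    field_simp
  have int : IntervalIntegrable
      (fun x : ℝ => (x ^ (s - 1) - x ^ (p - 1)) * (1 - x) ^ (-c - 1)) volume 0 1 := by
    rw [intervalIntegrable_iff_integrableOn_Ioo_of_le zero_le_one] at i1 ⊢
    refine Integrable.mono' i1 (by fun_prop) ?_
    refine (ae_restrict_iff' measurableSet_Ioo).2 (Filter.Eventually.of_forall fun x hx => ?_)
    obtain ⟨h1, h2⟩ := hbd x hx.1.le hx.2 hx.1
    have h3 : 0 < (1 - x) ^ (-c - 1) := Real.rpow_pos_of_pos (by linarith [hx.2]) _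
    have e : x ^ s - x ^ p = (x ^ (s - 1) - x ^ (p - 1)) * x := by
      rw [hs1 x hx.1 s, hs1 x hx.1 p]; ring
    rw [e] at h1 h2
    rw [hs1 x hx.1 s] at h2
    have h4 : 0 ≤ x ^ (s - 1) - x ^ (p - 1) := nonneg_of_mul_nonneg_left h1 hx.1
    have h5 : x ^ (s - 1) - x ^ (p - 1) ≤ x ^ (s - 1) * (1 - x) := by
      refine le_of_mul_le_mul_right ?_ hx.1
      linarith
    rw [Real.norm_of_nonneg (mul_nonneg h4 h3.le), hcx x hx.2]
    nlinarith
  refine ⟨int, ?_⟩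
  have FTC := intervalIntegral.integral_eq_sub_of_hasDerivAt_of_le (a := 0) (b := 1)
    (f := fun x : ℝ => (x ^ s - x ^ p) * (1 - x) ^ (-c))
    (f' := fun x : ℝ => c * ((x ^ (s - 1) - x ^ (p - 1)) * (1 - x) ^ (-c - 1))
      + ((s - c) * (x ^ (s - 1) * (1 - x) ^ (-c)) - (p - c) * (x ^ (p - 1) * (1 - x) ^ (-c))))
    zero_le_one ?_ ?_ ((int.const_mul _).add ((i1.const_mul _).sub (i2.const_mul _)))
  · rw [intervalIntegral.integral_add (int.const_mul _) ((i1.const_mul _).sub (i2.const_mul _)),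
      intervalIntegral.integral_sub (i1.const_mul _) (i2.const_mul _),
      intervalIntegral.integral_const_mul, intervalIntegral.integral_const_mul,
      intervalIntegral.integral_const_mul, e1, e2] at FTC
    have g1 : Real.Gamma (s + (1 - c)) = (s - c) * Real.Gamma (s - c) := by
      rw [← Real.Gamma_add_one (by linarith)]; congr 1; ring
    have g2 : Real.Gamma (p + (1 - c)) = (p - c) * Real.Gamma (p - c) := by
      rw [← Real.Gamma_add_one (by linarith)]; congr 1; ring
    have g3 : Real.Gamma (1 - c) = (-c) * Real.Gamma (-c) := by
      rw [← Real.Gamma_add_one (by linarith)]; congr 1; ring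
    have n1 := (Real.Gamma_pos_of_pos (show 0 < s - c by linarith)).ne'
    have n2 := (Real.Gamma_pos_of_pos (show 0 < p - c by linarith)).ne'
    have n3 : s - c ≠ 0 := by linarith
    have n4 : p - c ≠ 0 := by linarith
    rw [g1, g2, g3] at FTC
    simp only [Real.zero_rpow hs.ne', Real.zero_rpow hp.ne', Real.one_rpow, sub_self, zero_mul] at FTC
    generalize (∫ x in (0:ℝ)..1, (x ^ (s - 1) - x ^ (p - 1)) * (1 - x) ^ (-c - 1)) = I at *
    have hc0 := hc.ne'
    apply mul_left_cancel₀ hc0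
    field_simp at FTC ⊢
    rw [mul_zero] at FTC
    have := (mul_eq_zero.1 FTC).resolve_left hc0
    linarith
  · intro x hx
    rcases hx.2.lt_or_eq with h | h
    · apply ContinuousAt.continuousWithinAt
      refine ContinuousAt.mul (ContinuousAt.sub ?_ ?_) ?_
      · exact Real.continuousAt_rpow_const _ _ (Or.inr hs.le)
      · exact Real.continuousAt_rpow_const _ _ (Or.inr hp.le)
      · exact ContinuousAt.rpow_const (by fun_prop) (Or.inl (by linarith))
    · subst h
      have t : Filter.Tendsto (fun x : ℝ => (1 - x) ^ (1 - c)) (nhdsWithin 1 (Set.Icc 0 1))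
          (nhds 0) := by
        have : ContinuousAt (fun x : ℝ => (1 - x) ^ (1 - c)) 1 :=
          ContinuousAt.rpow_const (by fun_prop) (Or.inr (by linarith))
        have h := this.continuousWithinAt (s := Set.Icc 0 1)
        unfold ContinuousWithinAt at h
        simpa [Real.zero_rpow (show 1 - c ≠ 0 by linarith)] using h
      have v0 : (fun x : ℝ => (x ^ s - x ^ p) * (1 - x) ^ (-c)) 1 = 0 := by simp
      unfold ContinuousWithinAt
      rw [v0]
      refine squeeze_zero_norm' ?_ t
      filter_upwards [self_mem_nhdsWithin] with y hy
      rcases hy.2.lt_or_eq with h | h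
      · rcases hy.1.lt_or_eq with h' | h'
        · obtain ⟨h1, h2⟩ := hbd y hy.1 h h'
          have h3 : 0 < (1 - y) ^ (-c) := Real.rpow_pos_of_pos (by linarith) _
          have h4 : y ^ s ≤ 1 := Real.rpow_le_one hy.1 hy.2 hs.le
          rw [Real.norm_of_nonneg (mul_nonneg h1 h3.le), sub_eq_add_neg 1 c,
            Real.rpow_add (by linarith), Real.rpow_one]
          refine mul_le_mul_of_nonneg_right ?_ h3.le
          nlinarith
        · subst h'
          simp [Real.zero_rpow hs.ne', Real.zero_rpow hp.ne']
      · subst h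
        simp [Real.zero_rpow (show 1 - c ≠ 0 by linarith)]
  · intro x hx
    have d1 := (Real.hasDerivAt_rpow_const (x := x) (p := s) (Or.inl hx.1.ne'))
    have d2 := (Real.hasDerivAt_rpow_const (x := x) (p := p) (Or.inl hx.1.ne'))
    have d3 := ((hasDerivAt_id x).const_sub 1).rpow_const (p := -c)
      (Or.inl (by simp only [id]; linarith [hx.2]))
    convert! (d1.sub d2).mul d3 using 1
    simp only [id, Pi.sub_apply]
    rw [hcx x hx.2, hs1 x hx.1 s, hs1 x hx.1 p]
    ring

lemma pointwise_id (N : ℕ) (hN : 1 ≤ N) (s r : ℝ) (hr : 0 < r) :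
    r ^ (N - 1) * ((1 / (1 + r ^ 2)) ^ (((N : ℝ) - 2 * s) / 2) *
      (r ^ (-((N : ℝ) - 2 * s)) - (1 + r ^ 2) ^ (-(((N : ℝ) - 2 * s) / 2)))) =
    (1 / 2) * (|2 * r / (1 + r ^ 2) ^ 2| *
      (((r ^ 2 / (1 + r ^ 2)) ^ (s - 1) - (r ^ 2 / (1 + r ^ 2)) ^ ((N : ℝ) / 2 - 1)) *
        (1 - r ^ 2 / (1 + r ^ 2)) ^ (-(2 * s - (N : ℝ) / 2) - 1))) := by
  have hq : 0 < 1 + r ^ 2 := by positivity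
  have e1 : 1 - r ^ 2 / (1 + r ^ 2) = (1 + r ^ 2)⁻¹ := by field_simp; ring
  have e2 : r ^ (N - 1) = r ^ ((N : ℝ) - 1) := by
    rw [← Real.rpow_natCast]; congr 1; push_cast [hN]; ring
  have e3 : |2 * r / (1 + r ^ 2) ^ 2| = 2 * r / (1 + r ^ 2) ^ 2 := abs_of_pos (by positivity)
  have e4 : ∀ u : ℝ, (r ^ 2 / (1 + r ^ 2)) ^ u = r ^ (2 * u) * (1 + r ^ 2) ^ (-u) := by
    intro u
    rw [Real.div_rpow (by positivity) hq.le, Real.rpow_neg hq.le, div_eq_mul_inv]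
    congr 1
    rw [Real.rpow_mul hr.le]; norm_num
  rw [e1, e2, e3, e4, e4, one_div, Real.inv_rpow hq.le, Real.inv_rpow hq.le,
    ← Real.rpow_neg hq.le, ← Real.rpow_neg hq.le]
  generalize hqq : 1 + r ^ 2 = q at *
  have e5 : 2 * r / q ^ 2 = 2 * (r ^ (1:ℝ) * q ^ (-2:ℝ)) := by
    rw [Real.rpow_neg hq.le, Real.rpow_one]; norm_num; ring
  rw [e5]
  have L : ∀ A B C D E : ℝ, r ^ A * (q ^ B * (r ^ C - q ^ D)) =
      r ^ (A + C) * q ^ B - r ^ A * q ^ (B + D) := by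
    intro A B C D E
    rw [Real.rpow_add hr, Real.rpow_add hq]; ring
  have M : ∀ A B C D E F G : ℝ, 1 / 2 * (2 * (r ^ A * q ^ B) * ((r ^ C * q ^ D - r ^ E * q ^ F) * q ^ G))
      = r ^ (A + C) * q ^ (B + D + G) - r ^ (A + E) * q ^ (B + F + G) := by
    intro A B C D E F G
    simp only [Real.rpow_add hr, Real.rpow_add hq]; ring
  rw [L _ _ _ _ 0, M]
  congr 3 <;> ring

lemma change_var (f : ℝ → ℝ) (g : ℝ → ℝ)
    (h : ∀ r : ℝ, 0 < r → g r = (1 / 2) * (|2 * r / (1 + r ^ 2) ^ 2| * f (r ^ 2 / (1 + r ^ 2))))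
    (hf : IntegrableOn f (Set.Ioo 0 1)) :
    IntegrableOn g (Set.Ioi 0) ∧
      ∫ r in Set.Ioi (0:ℝ), g r = (1 / 2) * ∫ x in Set.Ioo (0:ℝ) 1, f x := by
  have himg : (fun r : ℝ => r ^ 2 / (1 + r ^ 2)) '' Set.Ioi 0 = Set.Ioo 0 1 := by
    ext x
    simp only [Set.mem_image, Set.mem_Ioi, Set.mem_Ioo]
    constructor
    · rintro ⟨r, hr, rfl⟩
      exact ⟨by positivity, by rw [div_lt_one (by positivity)]; linarith⟩
    · rintro ⟨h0, h1⟩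
      have h2 : 0 < 1 - x := by linarith
      refine ⟨Real.sqrt (x / (1 - x)), Real.sqrt_pos.2 (by positivity), ?_⟩
      rw [Real.sq_sqrt (by positivity)]
      field_simp
      ring
  have hinj : Set.InjOn (fun r : ℝ => r ^ 2 / (1 + r ^ 2)) (Set.Ioi 0) := by
    intro a ha b hb hab
    simp only [Set.mem_Ioi] at ha hb
    simp only at hab
    rw [div_eq_div_iff (by positivity) (by positivity)] at hab
    have : a ^ 2 = b ^ 2 := by linarith
    exact (pow_left_inj₀ ha.le hb.le two_ne_zero).1 this
  have hder : ∀ r ∈ Set.Ioi (0:ℝ), HasDerivWithinAt (fun r : ℝ => r ^ 2 / (1 + r ^ 2))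
      (2 * r / (1 + r ^ 2) ^ 2) (Set.Ioi 0) r := by
    intro r hr
    apply HasDerivAt.hasDerivWithinAt
    have hd := hasDerivAt_pow 2 r
    convert! hd.div (hd.const_add 1) (by positivity) using 1
    simp
    ring
  have I1 := integrableOn_image_iff_integrableOn_abs_deriv_smul measurableSet_Ioi hder hinj f
  have I2 := integral_image_eq_integral_abs_deriv_smul measurableSet_Ioi hder hinj f
  rw [himg] at I1 I2
  simp only [smul_eq_mul] at I1 I2
  constructor
  · refine IntegrableOn.congr_fun ((I1.1 hf).const_mul (1 / 2)) ?_ measurableSet_Ioi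
    exact fun r hr => (h r hr).symm
  · rw [setIntegral_congr_fun (s := Set.Ioi 0) measurableSet_Ioi (fun r hr => h r hr), integral_const_mul, I2]

/-- value of `α_{N,s}`, from Lemma C.1: for `2s < N < 4s`,
`y ↦ U_{0,1}(y) h(y)` is integrable on `ℝ^N` and
`∫ U_{0,1} h = (π^{N/2}/Γ(N/2)) Γ(N/2-2s) (Γ(s)/Γ(N/2-s) - Γ(N/2)/Γ(N-2s))`,
where `Γ` is the Gamma function (extended to negative non-integer arguments). -/
theorem statement14 (N : ℕ) (s : ℝ) (hs0 : 0 < s) (hs1 : s < 1)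
    (hN1 : 2 * s < (N : ℝ)) (hN2 : (N : ℝ) < 4 * s) :
    Integrable (fun y : Euc N => bubble N s 0 1 y * hfun N s y)
        (volume : Measure (Euc N)) ∧
      (∫ y : Euc N, bubble N s 0 1 y * hfun N s y) =
        Real.pi ^ ((N : ℝ) / 2) / Real.Gamma ((N : ℝ) / 2) *
          Real.Gamma ((N : ℝ) / 2 - 2 * s) *
            (Real.Gamma s / Real.Gamma ((N : ℝ) / 2 - s) -
              Real.Gamma ((N : ℝ) / 2) / Real.Gamma ((N : ℝ) - 2 * s)) := by
  have hN : 1 ≤ N := by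
    by_contra hh
    have : N = 0 := by omega
    subst this
    norm_num at hN1
    linarith
  have : Nonempty (Fin N) := ⟨⟨0, hN⟩⟩
  have : Nontrivial (Euc N) := inferInstance
  obtain ⟨i, e⟩ := one_dim s ((N : ℝ) / 2) (2 * s - (N : ℝ) / 2) hs0 (by linarith) (by linarith)
    (by linarith) (by linarith) (by linarith)
  rw [intervalIntegrable_iff_integrableOn_Ioo_of_le zero_le_one] at i
  rw [intervalIntegral.integral_of_le zero_le_one, integral_Ioc_eq_integral_Ioo] at e
  obtain ⟨j, k⟩ := change_var _ _ (fun r hr => pointwise_id N hN s r hr) i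
  obtain ⟨F, hF⟩ : ∃ F : ℝ → ℝ, F = fun r : ℝ => (1 / (1 + r ^ 2)) ^ (((N : ℝ) - 2 * s) / 2) *
      (r ^ (-((N : ℝ) - 2 * s)) - (1 + r ^ 2) ^ (-(((N : ℝ) - 2 * s) / 2))) := ⟨_, rfl⟩
  have hfun_eq : (fun y : Euc N => bubble N s 0 1 y * hfun N s y) = fun y : Euc N => F ‖y‖ := by
    funext y
    simp [bubble, hfun, hF]
  have hdim : Module.finrank ℝ (Euc N) = N := by simp
  rw [hfun_eq]
  constructor
  · rw [integrable_fun_norm_addHaar (volume : Measure (Euc N)) (f := F), hdim, hF]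
    exact j
  · rw [integral_fun_norm_addHaar (volume : Measure (Euc N)) F, hdim, hF]
    simp only [smul_eq_mul, nsmul_eq_mul]
    rw [k, e]
    have hvol : (volume : Measure (Euc N)).real (Metric.ball 0 1) =
        Real.pi ^ ((N : ℝ) / 2) / Real.Gamma ((N : ℝ) / 2 + 1) := by
      rw [Measure.real, EuclideanSpace.volume_ball]
      simp only [Fintype.card_fin, ENNReal.ofReal_one, one_pow, one_mul]
      rw [ENNReal.toReal_ofReal (by positivity), Real.sqrt_eq_rpow, ← Real.rpow_natCast,
        ← Real.rpow_mul Real.pi_pos.le]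
      congr 2
      ring
    have hN0 : (0:ℝ) < N := by exact_mod_cast hN
    have hG := (Real.Gamma_pos_of_pos (show 0 < (N:ℝ) / 2 by positivity)).ne'
    rw [hvol, Real.Gamma_add_one (by positivity)]
    rw [show -(2 * s - (N : ℝ) / 2) = (N : ℝ) / 2 - 2 * s by ring,
      show s - (2 * s - (N : ℝ) / 2) = (N : ℝ) / 2 - s by ring,
      show (N : ℝ) / 2 - (2 * s - (N : ℝ) / 2) = (N : ℝ) - 2 * s by ring]
    field_simp
end
end
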